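/- arXiv:1902.08549 — 4 statements merged into one kernel-verified Lean document; each statement's English description precedes it below -/
import Mathlib

section
/- Let D = 2d with d ≥ 1, let U ⊆ ℝ^D be open, and let I : U → Matrix (Fin D) (Fin D) ℝ be a C¹ map with I(x)·I(x) = -1 (minus the identity matrix) for every x ∈ U. Suppose there exist twice continuously differentiable functions z^1, …, z^d : U → ℂ, each satisfying the complex-coordinate equations for I, such that at every point of U the real Jacobian matrix of the map (Re z^1, Im z^1, …, Re z^d, Im z^d) : U → ℝ^{2d} is invertible. Then the Nijenhuis tensor of I vanishes identically on U. -/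
open scoped BigOperators

/-- Partial derivative in the `P`-th coordinate direction of a real-valued function on `ℝ^D`. -/
noncomputable def pd {D : ℕ} (f : (Fin D → ℝ) → ℝ) (P : Fin D) (x : Fin D → ℝ) : ℝ :=
  fderiv ℝ f x (Pi.single P 1)

/-- Partial derivative in the `P`-th coordinate direction of a complex-valued function on `ℝ^D`. -/
noncomputable def pdC {D : ℕ} (f : (Fin D → ℝ) → ℂ) (P : Fin D) (x : Fin D → ℝ) : ℂ :=
  fderiv ℝ f x (Pi.single P 1)

/-- The Nijenhuis tensor `N_{MN}{}^K` of a matrix field `I` on `ℝ^D`. -/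
noncomputable def nijenhuis {D : ℕ} (I : (Fin D → ℝ) → Matrix (Fin D) (Fin D) ℝ)
    (x : Fin D → ℝ) (M N K : Fin D) : ℝ :=
  (pd (fun y => I y N K) M x - pd (fun y => I y M K) N x)
    - ∑ P, ∑ Q, I x M P * I x N Q *
        (pd (fun y => I y Q K) P x - pd (fun y => I y P K) Q x)

/-- `z` satisfies the complex-coordinate equations `∂_M z - i I_M{}^N ∂_N z = 0` for `I` at `x`. -/
def ComplexCoordEq {D : ℕ} (I : (Fin D → ℝ) → Matrix (Fin D) (Fin D) ℝ)
    (z : (Fin D → ℝ) → ℂ) (x : Fin D → ℝ) : Prop :=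
  ∀ M : Fin D, pdC z M x - Complex.I * ∑ N, (I x M N : ℂ) * pdC z N x = 0

lemma pd_re {D : ℕ} {z : (Fin D → ℝ) → ℂ} {x : Fin D → ℝ} (hz : DifferentiableAt ℝ z x)
    (P : Fin D) : pd (fun y => (z y).re) P x = (pdC z P x).re := by
  have h : HasFDerivAt (fun y => (z y).re) (Complex.reCLM.comp (fderiv ℝ z x)) x :=
    Complex.reCLM.hasFDerivAt.comp x hz.hasFDerivAt
  simp [pd, pdC, h.fderiv]

lemma pd_im {D : ℕ} {z : (Fin D → ℝ) → ℂ} {x : Fin D → ℝ} (hz : DifferentiableAt ℝ z x)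
    (P : Fin D) : pd (fun y => (z y).im) P x = (pdC z P x).im := by
  have h : HasFDerivAt (fun y => (z y).im) (Complex.imCLM.comp (fderiv ℝ z x)) x :=
    Complex.imCLM.hasFDerivAt.comp x hz.hasFDerivAt
  simp [pd, pdC, h.fderiv]

lemma differentiableAt_pdC {D : ℕ} {z : (Fin D → ℝ) → ℂ} {x : Fin D → ℝ}
    (hz : ContDiffAt ℝ 2 z x) (P : Fin D) : DifferentiableAt ℝ (pdC z P) x :=
  ((hz.fderiv_right (m := 1) (by norm_num)).differentiableAt one_ne_zero).clm_apply
    (differentiableAt_const _)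

lemma pdC_pdC_comm {D : ℕ} {z : (Fin D → ℝ) → ℂ} {x : Fin D → ℝ} (hz : ContDiffAt ℝ 2 z x)
    (P Q : Fin D) : pdC (pdC z P) Q x = pdC (pdC z Q) P x := by
  have hd := (hz.fderiv_right (m := 1) (by norm_num)).differentiableAt one_ne_zero
  have key : ∀ P Q : Fin D, pdC (pdC z P) Q x =
      fderiv ℝ (fderiv ℝ z) x (Pi.single Q 1) (Pi.single P 1) := fun P Q => by
    have h : HasFDerivAt (pdC z P) ((fderiv ℝ (fderiv ℝ z) x).flip (Pi.single P 1)) x := by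
      have := hd.hasFDerivAt.clm_apply (hasFDerivAt_const (Pi.single P (1 : ℝ)) x)
      rwa [ContinuousLinearMap.comp_zero, zero_add] at this
    rw [pdC, h.fderiv, ContinuousLinearMap.flip_apply]
  rw [key, key]
  exact (hz.isSymmSndFDerivAt (by simp)) _ _

/-- The derivative of the complex-coordinate equations. -/
lemma pdC_pdC_eq_of_complexCoordEq {D : ℕ}
    {I : (Fin D → ℝ) → Matrix (Fin D) (Fin D) ℝ} {z : (Fin D → ℝ) → ℂ} {x : Fin D → ℝ}
    (hI : ∀ N K, DifferentiableAt ℝ (fun y => I y N K) x) (hz : ContDiffAt ℝ 2 z x)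
    (heq : ∀ᶠ y in nhds x, ComplexCoordEq I z y) (L M : Fin D) :
    pdC (pdC z M) L x = Complex.I * ∑ N, ((pd (fun y => I y M N) L x : ℂ) * pdC z N x +
      (I x M N : ℂ) * pdC (pdC z N) L x) := by
  have hev : pdC z M =ᶠ[nhds x] fun y => Complex.I * ∑ N, (I y M N : ℂ) * pdC z N y :=
    heq.mono fun y hy => sub_eq_zero.mp (hy M)
  have hterm : ∀ N, HasFDerivAt (fun y => (I y M N : ℂ) * pdC z N y) _ x := fun N =>
    (Complex.ofRealCLM.hasFDerivAt.comp x (hI M N).hasFDerivAt).mul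
      (differentiableAt_pdC hz N).hasFDerivAt
  have h := (HasFDerivAt.fun_sum (u := Finset.univ) fun N _ => hterm N).const_mul Complex.I
  rw [pdC, hev.fderiv_eq, h.fderiv]
  simp [pd, pdC, add_comm, mul_comm]

open Matrix in
/-- The Nijenhuis tensor of an almost complex structure annihilates the differential of every
function satisfying the complex-coordinate equations. -/
lemma sum_nijenhuis_mul_pdC_eq_zero {D : ℕ}
    {I : (Fin D → ℝ) → Matrix (Fin D) (Fin D) ℝ} {z : (Fin D → ℝ) → ℂ} {x : Fin D → ℝ}
    (hI : ∀ N K, DifferentiableAt ℝ (fun y => I y N K) x) (hI2 : I x * I x = -1)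
    (hz : ContDiffAt ℝ 2 z x) (heq : ∀ᶠ y in nhds x, ComplexCoordEq I z y) (M N : Fin D) :
    ∑ K, (nijenhuis I x M N K : ℂ) * pdC z K x = 0 := by
  let J : Matrix (Fin D) (Fin D) ℂ := (I x).map (algebraMap ℝ ℂ)
  let H : Matrix (Fin D) (Fin D) ℂ := of fun L M => pdC (pdC z M) L x
  let B : Matrix (Fin D) (Fin D) ℂ :=
    of fun L M => ∑ K, (pd (fun y => I y M K) L x : ℂ) * pdC z K x
  have hJ : J * J = -1 := by
    rw [← Matrix.map_mul, hI2]
    ext i j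
    by_cases h : i = j <;> simp [h]
  have hJt : Jᵀ * Jᵀ = -1 := by rw [← transpose_mul, hJ]; simp
  have hH : Hᵀ = H := by
    ext i j
    exact pdC_pdC_comm hz i j
  have hB : H = Complex.I • (B + H * Jᵀ) := by
    ext i j
    simp only [H, B, J, of_apply, Matrix.smul_apply, Matrix.add_apply, mul_apply, transpose_apply, map_apply,
      smul_eq_mul]
    rw [pdC_pdC_eq_of_complexCoordEq hI hz heq, ← Finset.sum_add_distrib]
    simp [mul_comm]
  have hB' : B = -(Complex.I • H) - H * Jᵀ := by
    have : Complex.I • H = -(B + H * Jᵀ) := by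
      conv_lhs => rw [hB]
      rw [smul_smul, Complex.I_mul_I, neg_one_smul]
    rw [this]; abel
  have hA : B - Bᵀ = J * H - H * Jᵀ := by
    rw [hB']
    simp only [transpose_sub, transpose_neg, transpose_smul, transpose_mul, transpose_transpose,
      hH]
    abel
  have hA' : (B - Bᵀ) - J * (B - Bᵀ) * Jᵀ = 0 := by
    have h1 : J * (J * H - H * Jᵀ) * Jᵀ = J * J * (H * Jᵀ) - J * H * (Jᵀ * Jᵀ) := by
      noncomm_ring
    rw [hA, h1, hJ, hJt]
    noncomm_ring
  have hMN := congrFun (congrFun hA' M) N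
  rw [Matrix.zero_apply] at hMN
  rw [← hMN]
  have hAe : ∀ P Q, (B - Bᵀ) P Q = ∑ K,
      ((pd (fun y => I y Q K) P x - pd (fun y => I y P K) Q x : ℝ) : ℂ) * pdC z K x := by
    intro P Q
    simp [B, sub_mul, Finset.sum_sub_distrib]
  have hAe' : (J * (B - Bᵀ) * Jᵀ) M N = ∑ P, ∑ Q, J M P * J N Q * (B - Bᵀ) P Q := by
    rw [mul_apply, Finset.sum_comm]
    simp only [mul_apply, Finset.sum_mul, transpose_apply]
    exact Finset.sum_congr rfl fun Q _ => Finset.sum_congr rfl fun P _ => by ring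
  rw [Matrix.sub_apply, hAe', hAe]
  simp only [hAe, nijenhuis, Complex.ofReal_sub (_ - _), sub_mul (Complex.ofReal _),
    Finset.sum_sub_distrib]
  congr 1
  simp only [Complex.ofReal_sum, Finset.sum_mul, Finset.mul_sum]
  rw [Finset.sum_comm]
  refine Finset.sum_congr rfl fun P _ => ?_
  rw [Finset.sum_comm]
  refine Finset.sum_congr rfl fun Q _ => Finset.sum_congr rfl fun K _ => ?_
  simp [J, mul_assoc]

theorem nijenhuis_vanishes_of_complex_coords (d : ℕ) (hd : 1 ≤ d)
    (U : Set (Fin (2 * d) → ℝ)) (hU : IsOpen U)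
    (I : (Fin (2 * d) → ℝ) → Matrix (Fin (2 * d)) (Fin (2 * d)) ℝ)
    (hIsmooth : ∀ N K : Fin (2 * d), ContDiffOn ℝ 1 (fun y => I y N K) U)
    (hI2 : ∀ x ∈ U, I x * I x = -1)
    (z : Fin d → ((Fin (2 * d) → ℝ) → ℂ))
    (hz : ∀ n, ContDiffOn ℝ 2 (z n) U)
    (hzeq : ∀ n, ∀ x ∈ U, ComplexCoordEq I (z n) x)
    (hjac : ∀ x ∈ U,
      IsUnit (Matrix.of fun p q : Fin d × Fin 2 =>
        pd (fun y => if p.2 = 0 then (z p.1 y).re else (z p.1 y).im)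
          ((finProdFinEquiv.trans (finCongr (by ring : d * 2 = 2 * d))) q) x)) :
    ∀ x ∈ U, ∀ M N K : Fin (2 * d), nijenhuis I x M N K = 0 := by
  intro x hx M N K
  have hUx : U ∈ nhds x := hU.mem_nhds hx
  have hI : ∀ N K, DifferentiableAt ℝ (fun y => I y N K) x := fun N K =>
    ((hIsmooth N K).contDiffAt hUx).differentiableAt one_ne_zero
  have hC : ∀ n, ∑ K, (nijenhuis I x M N K : ℂ) * pdC (z n) K x = 0 := fun n =>
    sum_nijenhuis_mul_pdC_eq_zero hI (hI2 x hx) ((hz n).contDiffAt hUx)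
      (Filter.eventually_of_mem hUx (hzeq n)) M N
  have hzd : ∀ n, DifferentiableAt ℝ (z n) x := fun n =>
    ((hz n).contDiffAt hUx).differentiableAt two_ne_zero
  set e := finProdFinEquiv.trans (finCongr (by ring : d * 2 = 2 * d))
  have hv := Matrix.mulVec_injective_of_isUnit (hjac x hx)
    (a₁ := fun q => nijenhuis I x M N (e q)) (a₂ := 0) (by
      rw [Matrix.mulVec_zero]
      ext ⟨n, s⟩
      simp only [Matrix.mulVec, dotProduct, Matrix.of_apply, Pi.zero_apply]
      rw [e.sum_comp (fun k => pd (fun y => if s = 0 then (z n y).re else (z n y).im) k x *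
        nijenhuis I x M N k)]
      by_cases hs : s = 0
      · simp only [hs, if_true, pd_re (hzd n)]
        simpa [mul_comm] using congrArg Complex.re (hC n)
      · simp only [hs, if_false, pd_im (hzd n)]
        simpa [mul_comm] using congrArg Complex.im (hC n))
  simpa using congrFun hv (e.symm K)
end

section
/- Let U ⊆ ℝ² be open and let I : U → Matrix (Fin 2) (Fin 2) ℝ be a differentiable map with I(x)·I(x) = -1 (minus the identity matrix) for every x ∈ U. Then the Nijenhuis tensor of I vanishes identically on U: N_{MN}{}^K(x) = 0 for all x ∈ U and all indices M, N, K. -/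
open scoped BigOperators

/-- A real `2 × 2` matrix squaring to `-1` has determinant one. -/
theorem Matrix.det_eq_one_of_mul_self_eq_neg_one (A : Matrix (Fin 2) (Fin 2) ℝ)
    (hA : A * A = -1) : A.det = 1 := by
  have h00 : A 0 0 * A 0 0 + A 0 1 * A 1 0 = -1 := by
    simpa [Matrix.mul_apply] using congr_fun (congr_fun hA 0) 0
  have h01 : A 0 0 * A 0 1 + A 0 1 * A 1 1 = 0 := by
    simpa [Matrix.mul_apply] using congr_fun (congr_fun hA 0) 1
  have htrace : A 0 0 + A 1 1 = 0 := by
    have hb : A 0 1 ≠ 0 := by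
      intro hb
      rw [hb] at h00
      nlinarith [mul_self_nonneg (A 0 0)]
    apply mul_left_cancel₀ hb
    linear_combination h01
  rw [Matrix.det_fin_two]
  linear_combination A 0 0 * htrace - h00

/-- In two dimensions the Nijenhuis tensor is `1 - det I` times the exterior derivative of `I`. -/
theorem nijenhuis_fin_two (I : (Fin 2 → ℝ) → Matrix (Fin 2) (Fin 2) ℝ) (x : Fin 2 → ℝ)
    (M N K : Fin 2) :
    nijenhuis I x M N K =
      (1 - (I x).det) * (pd (fun y => I y N K) M x - pd (fun y => I y M K) N x) := by
  rw [Matrix.det_fin_two]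
  fin_cases M <;> fin_cases N <;> simp [nijenhuis, Fin.sum_univ_two] <;> ring

/-- In two dimensions the Nijenhuis tensor of any differentiable field of almost complex
structures vanishes identically. -/
theorem nijenhuis_vanishes_in_dim_two
    (U : Set (Fin 2 → ℝ)) (hU : IsOpen U)
    (I : (Fin 2 → ℝ) → Matrix (Fin 2) (Fin 2) ℝ)
    (hIdiff : ∀ N K : Fin 2, DifferentiableOn ℝ (fun y => I y N K) U)
    (hI2 : ∀ x ∈ U, I x * I x = -1) :
    ∀ x ∈ U, ∀ M N K : Fin 2, nijenhuis I x M N K = 0 := by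
  intro x hx M N K
  rw [nijenhuis_fin_two, Matrix.det_eq_one_of_mul_self_eq_neg_one _ (hI2 x hx), sub_self, zero_mul]
end

section
/- Let U ⊆ ℝ^D be open, let I₀ be a constant D×D real matrix, and let Δ : U → Matrix (Fin D) (Fin D) ℝ be a differentiable map. For t ∈ ℝ let N(t) denote the Nijenhuis tensor of the matrix field I₀ + tΔ (the defining formula applied to I₀ + tΔ, whether or not its square is -1). Then for every x ∈ U and all indices P, N, M, the derivative of t ↦ N(t)_{PN}{}^M(x) at t = 0 equals (∂_P Δ_N{}^M - ∂_N Δ_P{}^M)(x) - Σ_{Q,S} (I₀)_P{}^Q (I₀)_N{}^S (∂_Q Δ_S{}^M - ∂_S Δ_Q{}^M)(x); i.e., the linearized Nijenhuis condition at I₀ is ∂_P Δ_N{}^M - ∂_N Δ_P{}^M = (I₀)_P{}^Q (I₀)_N{}^S [∂_Q Δ_S{}^M - ∂_S Δ_Q{}^M]. -/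
open scoped BigOperators

/-- The partial derivative of `c + t * f` is `t` times the partial derivative of `f`; for `t = 0`
or `f` not differentiable this holds by the conventions for `fderiv`. -/
theorem pd_const_add_mul {D : ℕ} (c t : ℝ) (f : (Fin D → ℝ) → ℝ) (P : Fin D) (x : Fin D → ℝ) :
    pd (fun y => c + t * f y) P x = t * pd f P x := by
  simp only [pd, fderiv_const_add]
  change fderiv ℝ (t • f) x _ = _
  rw [fderiv_const_smul_field]
  rfl

/-- The entries of `I₀ + t Δ` in the Nijenhuis tensor, expanded in `t`. -/
theorem nijenhuis_const_add_smul {D : ℕ} (I₀ : Matrix (Fin D) (Fin D) ℝ)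
    (Δ : (Fin D → ℝ) → Matrix (Fin D) (Fin D) ℝ) (x : Fin D → ℝ) (P N M : Fin D) (t : ℝ) :
    nijenhuis (fun y => I₀ + t • Δ y) x P N M =
      t * ((pd (fun y => Δ y N M) P x - pd (fun y => Δ y P M) N x)
        - ∑ Q, ∑ S, (I₀ P Q + t * Δ x P Q) * (I₀ N S + t * Δ x N S) *
            (pd (fun y => Δ y S M) Q x - pd (fun y => Δ y Q M) S x)) := by
  simp only [nijenhuis, Matrix.add_apply, Matrix.smul_apply, smul_eq_mul, pd_const_add_mul,
    mul_sub, Finset.mul_sum]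
  congr 1
  refine Finset.sum_congr rfl fun Q _ => Finset.sum_congr rfl fun S _ => ?_
  ring

/-- Linearization of the Nijenhuis tensor around a constant almost complex structure `I₀`:
the derivative at `t = 0` of the Nijenhuis tensor of `I₀ + t Δ` is
`(∂_P Δ_N{}^M - ∂_N Δ_P{}^M) - Σ_{Q,S} (I₀)_P{}^Q (I₀)_N{}^S (∂_Q Δ_S{}^M - ∂_S Δ_Q{}^M)`. -/
theorem linearized_nijenhuis
    (D : ℕ) (U : Set (Fin D → ℝ)) (hU : IsOpen U)
    (I₀ : Matrix (Fin D) (Fin D) ℝ)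
    (Δ : (Fin D → ℝ) → Matrix (Fin D) (Fin D) ℝ)
    (hΔdiff : ∀ N K : Fin D, DifferentiableOn ℝ (fun y => Δ y N K) U) :
    ∀ x ∈ U, ∀ P N M : Fin D,
      HasDerivAt (fun t : ℝ => nijenhuis (fun y => I₀ + t • Δ y) x P N M)
        ((pd (fun y => Δ y N M) P x - pd (fun y => Δ y P M) N x)
          - ∑ Q, ∑ S, I₀ P Q * I₀ N S *
              (pd (fun y => Δ y S M) Q x - pd (fun y => Δ y Q M) S x))
        0 := by
  intro x _ P N M
  simp only [nijenhuis_const_add_smul]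
  let g : ℝ → ℝ := fun t => (pd (fun y => Δ y N M) P x - pd (fun y => Δ y P M) N x)
    - ∑ Q, ∑ S, (I₀ P Q + t * Δ x P Q) * (I₀ N S + t * Δ x N S) *
        (pd (fun y => Δ y S M) Q x - pd (fun y => Δ y Q M) S x)
  have hg : DifferentiableAt ℝ g 0 := by fun_prop
  refine ((hasDerivAt_id (0 : ℝ)).mul hg.hasDerivAt).congr_deriv ?_
  simp [g]
end

section
/- Let U ⊆ ℝ^D be open and let I : U → Matrix (Fin D) (Fin D) ℝ be a differentiable map with I(x)·I(x) = -1 (minus the identity matrix) for every x ∈ U. Then the following two conditions are equivalent: (a) for every x ∈ U and all indices N, K, M: Σ_L [ (∂_L I_N{}^M) I_K{}^L - (∂_L I_K{}^M) I_N{}^L + (∂_N I_K{}^L - ∂_K I_N{}^L) I_L{}^M ](x) = 0; (b) the Nijenhuis tensor of I vanishes identically on U. (Condition (a) is the closure condition for the second supersymmetry transformation δ̃X^M = η̃ I_N{}^M(X) D X^N of the N=1 superfields, so this is the statement that the N=2 supersymmetry algebra holds if and only if the Nijenhuis tensor vanishes.) -/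
open scoped BigOperators

/-- Differentiating `I * I = -1` gives `(∂_P I) * I + I * (∂_P I) = 0`. -/
lemma sum_pd_mul_add_mul_pd_eq_zero {D : ℕ} {U : Set (Fin D → ℝ)} (hU : IsOpen U)
    {I : (Fin D → ℝ) → Matrix (Fin D) (Fin D) ℝ}
    (hIdiff : ∀ N K : Fin D, DifferentiableOn ℝ (fun y => I y N K) U)
    (hI2 : ∀ x ∈ U, I x * I x = -1) {x : Fin D → ℝ} (hx : x ∈ U) (P K M : Fin D) :
    ∑ L, (pd (fun y => I y K L) P x * I x L M + I x K L * pd (fun y => I y L M) P x) = 0 := by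
  have hd (N K : Fin D) : HasFDerivAt (fun y => I y N K) (fderiv ℝ (fun y => I y N K) x) x :=
    ((hIdiff N K).differentiableAt (hU.mem_nhds hx)).hasFDerivAt
  have hsum := HasFDerivAt.fun_sum (u := Finset.univ) fun L _ => (hd K L).mul (hd L M)
  have hconst : (fun y => ∑ L, I y K L * I y L M) =ᶠ[nhds x]
      fun _ => (-1 : Matrix (Fin D) (Fin D) ℝ) K M := by
    filter_upwards [hU.mem_nhds hx] with y hy
    rw [← hI2 y hy, Matrix.mul_apply]
  have hzero := hsum.unique ((hasFDerivAt_const _ x).congr_of_eventuallyEq hconst)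
  have happ := DFunLike.congr_fun hzero (Pi.single P 1)
  simp only [sum_apply, add_apply, smul_apply, smul_eq_mul, zero_apply] at happ
  rw [← happ]
  refine Finset.sum_congr rfl fun L _ => ?_
  simp only [pd]
  ring

/-- The curl `∂_M I_N{}^K - ∂_N I_M{}^K` of a matrix field, as a matrix in `M` and `N`. -/
noncomputable def curlMatrix {D : ℕ} (I : (Fin D → ℝ) → Matrix (Fin D) (Fin D) ℝ)
    (x : Fin D → ℝ) (K : Fin D) : Matrix (Fin D) (Fin D) ℝ :=
  Matrix.of fun M N => pd (fun y => I y N K) M x - pd (fun y => I y M K) N x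

lemma nijenhuis_eq_curlMatrix {D : ℕ} (I : (Fin D → ℝ) → Matrix (Fin D) (Fin D) ℝ)
    (x : Fin D → ℝ) (M N K : Fin D) :
    nijenhuis I x M N K =
      (curlMatrix I x K - I x * curlMatrix I x K * (I x).transpose) M N := by
  simp only [nijenhuis, curlMatrix, Matrix.sub_apply, Matrix.mul_apply, Matrix.of_apply,
    Matrix.transpose_apply, Finset.sum_mul]
  rw [Finset.sum_comm]
  congr 1
  refine Finset.sum_congr rfl fun Q _ => Finset.sum_congr rfl fun P _ => ?_
  ring

lemma susy_closure_eq_curlMatrix {D : ℕ} {U : Set (Fin D → ℝ)} (hU : IsOpen U)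
    {I : (Fin D → ℝ) → Matrix (Fin D) (Fin D) ℝ}
    (hIdiff : ∀ N K : Fin D, DifferentiableOn ℝ (fun y => I y N K) U)
    (hI2 : ∀ x ∈ U, I x * I x = -1) {x : Fin D → ℝ} (hx : x ∈ U) (N K M : Fin D) :
    ∑ L, (pd (fun y => I y N M) L x * I x K L
        - pd (fun y => I y K M) L x * I x N L
        + (pd (fun y => I y K L) N x - pd (fun y => I y N L) K x) * I x L M) =
      (I x * curlMatrix I x M + curlMatrix I x M * (I x).transpose) K N := by
  have h₁ := sum_pd_mul_add_mul_pd_eq_zero hU hIdiff hI2 hx N K M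
  have h₂ := sum_pd_mul_add_mul_pd_eq_zero hU hIdiff hI2 hx K N M
  simp only [curlMatrix, Matrix.add_apply, Matrix.mul_apply, Matrix.of_apply,
    Matrix.transpose_apply]
  rw [← Finset.sum_add_distrib, ← sub_eq_zero, ← Finset.sum_sub_distrib, ← sub_zero (0 : ℝ)]
  nth_rewrite 1 [← h₁]
  rw [← h₂, ← Finset.sum_sub_distrib]
  refine Finset.sum_congr rfl fun L _ => ?_
  ring

/-- For a complex structure `J`, the equations `J F + F Jᵀ = 0` and `F = J F Jᵀ` agree. -/
lemma mul_add_mul_transpose_eq_zero_iff {n R : Type*} [Fintype n] [DecidableEq n] [CommRing R]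
    {J : Matrix n n R} (hJ : J * J = -1) (F : Matrix n n R) :
    J * F + F * J.transpose = 0 ↔ F - J * F * J.transpose = 0 := by
  have hJF : J * (J * F) = -F := by rw [← mul_assoc, hJ, neg_one_mul]
  have hJFJ : J * (J * F * J.transpose) = -(F * J.transpose) := by
    rw [← mul_assoc, hJF, neg_mul]
  constructor
  · intro h
    have := congrArg (J * ·) h
    simp only [mul_add, mul_zero, hJF, ← mul_assoc] at this
    rw [← neg_eq_zero, ← this]
    abel
  · intro h
    have := congrArg (J * ·) h
    simpa only [mul_sub, mul_zero, hJFJ, sub_neg_eq_add] using this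

/-- The `N = 2` supersymmetry algebra generated by the second supersymmetry transformation
`δ̃X^M = η̃ I_N{}^M(X) D X^N` closes iff the Nijenhuis tensor of `I` vanishes: the closure
condition `Σ_L [(∂_L I_N{}^M) I_K{}^L - (∂_L I_K{}^M) I_N{}^L + (∂_N I_K{}^L - ∂_K I_N{}^L) I_L{}^M] = 0`
is equivalent to `N_{MN}{}^K = 0` on `U`. -/
theorem susy_closure_iff_nijenhuis_vanishes
    (D : ℕ) (U : Set (Fin D → ℝ)) (hU : IsOpen U)
    (I : (Fin D → ℝ) → Matrix (Fin D) (Fin D) ℝ)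
    (hIdiff : ∀ N K : Fin D, DifferentiableOn ℝ (fun y => I y N K) U)
    (hI2 : ∀ x ∈ U, I x * I x = -1) :
    (∀ x ∈ U, ∀ N K M : Fin D,
        ∑ L, (pd (fun y => I y N M) L x * I x K L
              - pd (fun y => I y K M) L x * I x N L
              + (pd (fun y => I y K L) N x - pd (fun y => I y N L) K x) * I x L M) = 0)
      ↔ (∀ x ∈ U, ∀ M N K : Fin D, nijenhuis I x M N K = 0) := by
  refine forall₂_congr fun x hx => ?_
  simp only [susy_closure_eq_curlMatrix hU hIdiff hI2 hx, nijenhuis_eq_curlMatrix]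
  have key (K : Fin D) := mul_add_mul_transpose_eq_zero_iff (hI2 x hx) (curlMatrix I x K)
  constructor
  · intro h M N K
    rw [(key K).1 (Matrix.ext fun A B => h B A K), Matrix.zero_apply]
  · intro h N K M
    rw [(key M).2 (Matrix.ext fun A B => h A B M), Matrix.zero_apply]
end
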